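/- Let H = {h_1, ..., h_f} be the sequence of occurrences satisfying: h_1 is the earliest minimal occurrence with span at most T_X; each h_i is the earliest minimal occurrence with span at most T_X starting after h_{i-1}(v_N); and no minimal occurrence with span ≤ T_X starts after h_f(v_N). Then H is a maximum-cardinality set of pairwise non-overlapped occurrences of α with span at most T_X. -/

import Mathlib

variable {A : Type}

/-- An occurrence of the (N+1)-node serial episode `α` in the event sequence
`E` (of length `n`): a strictly increasing index map matching the event-types. -/
def IsOcc (E : ℕ → A) (n : ℕ) {N : ℕ} (α : Fin (N+1) → A) (h : Fin (N+1) → ℕ) : Prop :=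
  StrictMono h ∧ (∀ i, h i < n) ∧ (∀ i, E (h i) = α i)

/-- Earliest transiting occurrence: each `h i.succ` is the least index after
`h i.castSucc` carrying event-type `α i.succ`. -/
def IsET (E : ℕ → A) (n : ℕ) {N : ℕ} (α : Fin (N+1) → A) (h : Fin (N+1) → ℕ) : Prop :=
  IsOcc E n α h ∧ ∀ (i : Fin N) (j : ℕ), h i.castSucc < j → E j = α i.succ → h i.succ ≤ j

/-- Lexicographic order on occurrences. -/
def OccLex {N : ℕ} (h1 h2 : Fin (N+1) → ℕ) : Prop :=
  ∃ i, (∀ k < i, h1 k = h2 k) ∧ h1 i < h2 i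

/-- The window `[a, b]` contains an occurrence of `α`. -/
def WindowHasOcc (E : ℕ → A) (n : ℕ) {N : ℕ} (α : Fin (N+1) → A) (a b : ℕ) : Prop :=
  ∃ h, IsOcc E n α h ∧ a ≤ h 0 ∧ h (Fin.last N) ≤ b

/-- `[a, b]` is a minimal window of `α`: it contains an occurrence and no
proper subwindow contains one. -/
def IsMinWindow (E : ℕ → A) (n : ℕ) {N : ℕ} (α : Fin (N+1) → A) (a b : ℕ) : Prop :=
  WindowHasOcc E n α a b ∧
    ∀ c d, a ≤ c → d ≤ b → (a < c ∨ d < b) → ¬ WindowHasOcc E n α c d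

/-- A minimal occurrence: its window is a minimal window. -/
def IsMinOcc (E : ℕ → A) (n : ℕ) {N : ℕ} (α : Fin (N+1) → A) (h : Fin (N+1) → ℕ) : Prop :=
  IsOcc E n α h ∧ IsMinWindow E n α (h 0) (h (Fin.last N))

/-- `h'` is the earliest transiting occurrence immediately following `h`
in the lexicographic enumeration of earliest transiting occurrences. -/
def NextET (E : ℕ → A) (n : ℕ) {N : ℕ} (α : Fin (N+1) → A) (h h' : Fin (N+1) → ℕ) : Prop :=
  IsET E n α h ∧ IsET E n α h' ∧ OccLex h h' ∧
    ¬ ∃ g, IsET E n α g ∧ OccLex h g ∧ OccLex g h'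

/-- `h1 <⋆ h2` are non-interleaved: `h2 (v_j) ≥ h1 (v_{j+1})` for all `j < N`. -/
def NonInterleaved {N : ℕ} (h1 h2 : Fin (N+1) → ℕ) : Prop :=
  ∀ i : Fin N, h1 i.succ ≤ h2 i.castSucc

/-- Non-overlapped occurrences: one ends strictly before the other begins. -/
def NonOverlapped {N : ℕ} (h1 h2 : Fin (N+1) → ℕ) : Prop :=
  h1 (Fin.last N) < h2 0 ∨ h2 (Fin.last N) < h1 0

/-- The span of the occurrence `h` (w.r.t. the times `t`) is at most `TX`. -/
def SpanLe (t : ℕ → ℕ) {N : ℕ} (h : Fin (N+1) → ℕ) (TX : ℕ) : Prop :=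
  t (h (Fin.last N)) - t (h 0) ≤ TX

/-- The greedy sequence `h 0, …, h (f-1)` of non-overlapped minimal
occurrences with span at most `TX`, each chosen earliest (lexicographically
least) after the end of the previous one. -/
def GreedyMin (E : ℕ → A) (n : ℕ) {N : ℕ} (α : Fin (N+1) → A)
    (t : ℕ → ℕ) (TX f : ℕ) (h : ℕ → Fin (N+1) → ℕ) : Prop :=
  (∀ i < f, IsMinOcc E n α (h i) ∧ SpanLe t (h i) TX) ∧
  (0 < f → ∀ g, IsMinOcc E n α g → SpanLe t g TX → ¬ OccLex g (h 0)) ∧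
  (∀ i, i + 1 < f → h i (Fin.last N) < h (i+1) 0 ∧
    ∀ g, IsMinOcc E n α g → SpanLe t g TX → h i (Fin.last N) < g 0 →
      ¬ OccLex g (h (i+1)))

/-- No minimal occurrence of span at most `TX` starts after the end of the
last occurrence of the greedy sequence (and if any such occurrence exists at
all then the sequence is nonempty). -/
def GreedyComplete (E : ℕ → A) (n : ℕ) {N : ℕ} (α : Fin (N+1) → A)
    (t : ℕ → ℕ) (TX f : ℕ) (h : ℕ → Fin (N+1) → ℕ) : Prop :=
  ∀ g, IsMinOcc E n α g → SpanLe t g TX →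
    0 < f ∧ g 0 ≤ h (f-1) (Fin.last N)

theorem exists_minOcc (E : ℕ → A) (n : ℕ) {N : ℕ} (α : Fin (N+1) → A) :
    ∀ (w : ℕ) (g : Fin (N+1) → ℕ), IsOcc E n α g → g (Fin.last N) - g 0 ≤ w →
      ∃ g', IsMinOcc E n α g' ∧ g 0 ≤ g' 0 ∧ g' (Fin.last N) ≤ g (Fin.last N) := by
  intro w
  induction w using Nat.strong_induction_on with
  | _ w ih =>
    intro g hocc hw
    by_cases hm : IsMinOcc E n α g
    · exact ⟨g, hm, le_rfl, le_rfl⟩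
    · have hex : ∃ g2, IsOcc E n α g2 ∧ g 0 ≤ g2 0 ∧ g2 (Fin.last N) ≤ g (Fin.last N) ∧
          (g 0 < g2 0 ∨ g2 (Fin.last N) < g (Fin.last N)) := by
        by_contra hno
        refine hm ⟨hocc, ⟨g, hocc, le_rfl, le_rfl⟩, ?_⟩
        rintro c d hc hd hcd ⟨g2, h2, h20, h2l⟩
        exact hno ⟨g2, h2, by omega, by omega, by omega⟩
      obtain ⟨g2, h2, ha, hb, hab⟩ := hex
      have hle : g2 0 ≤ g2 (Fin.last N) := h2.1.monotone (Fin.zero_le _)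
      obtain ⟨g', h', h'0, h'l⟩ := ih (g2 (Fin.last N) - g2 0) (by omega) g2 h2 le_rfl
      exact ⟨g', h', by omega, by omega⟩

theorem start_le_of_not_occLex {N : ℕ} {g k : Fin (N+1) → ℕ} (hn : ¬ OccLex g k) :
    k 0 ≤ g 0 := by
  by_contra hlt
  exact hn ⟨0, fun j hj => absurd hj (Fin.not_lt_zero j), by omega⟩

theorem exists_greedy_end (E : ℕ → A) (n : ℕ) {N : ℕ} (α : Fin (N+1) → A)
    (t : ℕ → ℕ) (ht : StrictMono t) (TX f : ℕ) (h : ℕ → Fin (N+1) → ℕ)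
    (hg : GreedyMin E n α t TX f h)
    (hc : GreedyComplete E n α t TX f h) (g : Fin (N+1) → ℕ)
    (hocc : IsOcc E n α g) (hs : SpanLe t g TX) :
    ∃ i, i < f ∧ g 0 ≤ h i (Fin.last N) ∧ h i (Fin.last N) ≤ g (Fin.last N) := by
  classical
  obtain ⟨g', hm, h0, hl⟩ := exists_minOcc E n α _ g hocc le_rfl
  have hs' : SpanLe t g' TX := by
    have h1 := ht.monotone h0
    have h2 := ht.monotone hl
    unfold SpanLe at *
    omega
  obtain ⟨hf, hlast⟩ := hc g' hm hs'
  have hex : ∃ i, i < f ∧ g' 0 ≤ h i (Fin.last N) := ⟨f - 1, by omega, hlast⟩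
  obtain ⟨hif, hi⟩ := Nat.find_spec hex
  have hmin := fun m => Nat.find_min hex (m := m)
  generalize Nat.find hex = i at hif hi hmin
  have hstart : h i 0 ≤ g' 0 := by
    apply start_le_of_not_occLex
    cases i with
    | zero => exact hg.2.1 hf g' hm hs'
    | succ j =>
      refine (hg.2.2 j hif).2 g' hm hs' ?_
      by_contra hlt
      exact hmin j (by omega) ⟨by omega, by omega⟩
  refine ⟨i, hif, by omega, ?_⟩
  by_contra hlt
  exact (hg.1 i hif).1.2.2 (g' 0) (g' (Fin.last N)) hstart (by omega) (Or.inr (by omega))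
    ⟨g', hm.1, le_rfl, le_rfl⟩

theorem stmt10 (E : ℕ → A) (n : ℕ) {N : ℕ} (α : Fin (N+1) → A)
    (t : ℕ → ℕ) (ht : StrictMono t) (TX f : ℕ) (h : ℕ → Fin (N+1) → ℕ)
    (hg : GreedyMin E n α t TX f h)
    (hc : GreedyComplete E n α t TX f h) :
    (∀ i < f, IsOcc E n α (h i) ∧ SpanLe t (h i) TX) ∧
    (∀ i j, i < j → j < f → NonOverlapped (h i) (h j)) ∧
    (∀ S : Set (Fin (N+1) → ℕ), S.Finite →
      (∀ g ∈ S, IsOcc E n α g ∧ SpanLe t g TX) →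
      S.Pairwise NonOverlapped → S.ncard ≤ f) := by
  refine ⟨fun i hi => ⟨(hg.1 i hi).1.1, (hg.1 i hi).2⟩, ?_, ?_⟩
  · intro i j hij hj
    left
    induction j, hij using Nat.le_induction with
    | base => exact (hg.2.2 i hj).1
    | succ j hij ih =>
      have h1 := ih (by omega)
      have h2 := (hg.2.2 j hj).1
      have h3 : h j 0 ≤ h j (Fin.last N) :=
        (hg.1 j (by omega)).1.1.1.monotone (Fin.zero_le _)
      omega
  · intro S _ hS hp
    have hex : ∀ g, ∃ i, g ∈ S →
        i < f ∧ g 0 ≤ h i (Fin.last N) ∧ h i (Fin.last N) ≤ g (Fin.last N) := by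
      intro g
      by_cases hgS : g ∈ S
      · obtain ⟨i, hi⟩ := exists_greedy_end E n α t ht TX f h hg hc g (hS g hgS).1 (hS g hgS).2
        exact ⟨i, fun _ => hi⟩
      · exact ⟨0, fun hh => absurd hh hgS⟩
    choose φ hφ using hex
    have hcard := Set.ncard_le_ncard_of_injOn (s := S) (t := (Finset.range f : Set ℕ)) φ
      (fun g hgS => by simpa using (hφ g hgS).1)
      (by
        intro a ha b hb hab
        by_contra hne
        have h1 := hφ a ha
        have h2 := hφ b hb
        rw [← hab] at h2
        rcases hp ha hb hne with h3 | h3 <;> omega)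
      (Finset.finite_toSet _)
    rwa [Set.ncard_coe_finset, Finset.card_range] at hcard
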